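/- arXiv:1804.01281 — 10 statements merged into one kernel-verified Lean document; each statement's English description precedes it below -/
import Mathlib

section
/- Let N = kn + r with integers k ≥ 0 and 0 < r < n. Then the number of lattice points in ({0,…,N−1}^d) ∩ 𝒜^{(α)} equals ∑_{c=0}^{d} φ_c · N^c in ℚ, where for each 0 ≤ c ≤ d the rational number φ_c is given by φ_c = (1/n) · ∑_{i=c}^{d} (−1)^{i−c} · binom(i,c) · ψ_i^{(α)}(r) · r^{i−c}. -/
open Finset

/-- `gJ n t J = gcd({t_j : j ∈ J} ∪ {n})`, so `gJ n t ∅ = n`. -/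
def gJ {d : ℕ} (n : ℕ) (t : Fin d → ℕ) (J : Finset (Fin d)) : ℕ :=
  Nat.gcd (J.gcd t) n

/-- `theta n t α J r` is the number of tuples `(a_ℓ)_{ℓ ∉ J}` of integers with
`0 ≤ a_ℓ ≤ r − 1` and `∑_{ℓ ∉ J} t_ℓ a_ℓ ≡ α (mod gJ n t J)`. -/
def theta {d : ℕ} (n : ℕ) (t : Fin d → ℕ) (α : ℤ) (J : Finset (Fin d)) (r : ℕ) : ℕ :=
  ((Fintype.piFinset fun _ : {ℓ : Fin d // ℓ ∉ J} => Finset.range r).filter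
    fun a => (gJ n t J : ℤ) ∣ (∑ ℓ : {ℓ : Fin d // ℓ ∉ J}, (t ℓ.1 : ℤ) * a ℓ) - α).card

/-- `psi n t α i r = ∑_{J ⊆ {1,…,d}, |J| = i} gJ · θ_J^{(α)}(r)`. -/
def psi {d : ℕ} (n : ℕ) (t : Fin d → ℕ) (α : ℤ) (i : ℕ) (r : ℕ) : ℕ :=
  ∑ J ∈ Finset.univ.filter (fun J : Finset (Fin d) => J.card = i),
    gJ n t J * theta n t α J r

/-- Number of lattice points in `{0,…,N−1}^d ∩ 𝒜^{(α)}`, where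
`𝒜^{(α)} = {a ∈ ℤ^d : ∑ t_ℓ a_ℓ ≡ α (mod n)}`. -/
def latticeCount {d : ℕ} (n : ℕ) (t : Fin d → ℕ) (α : ℤ) (N : ℕ) : ℕ :=
  ((Fintype.piFinset fun _ : Fin d => Finset.range N).filter
    fun a => (n : ℤ) ∣ (∑ ℓ, (t ℓ : ℤ) * a ℓ) - α).card

/-- The homomorphism `(ℤ/n)^J → ℤ/n` sending `x` to `∑ t_j x_j`. -/
def weightedSumHom {ι : Type*} (n : ℕ) (t : ι → ℕ) (J : Finset ι) :
    (J → ZMod n) →+ ZMod n where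
  toFun x := ∑ j, (t j.1 : ZMod n) * x j
  map_zero' := by simp
  map_add' x y := by simp [mul_add, Finset.sum_add_distrib]

lemma weightedSumHom_apply {ι : Type*} (n : ℕ) (t : ι → ℕ) (J : Finset ι) (x : J → ZMod n) :
    weightedSumHom n t J x = ∑ j, (t j.1 : ZMod n) * x j := rfl

lemma ZMod.intCast_mem_zmultiples_natCast_iff {n g : ℕ} (hg : g ∣ n) (β : ℤ) :
    (β : ZMod n) ∈ AddSubgroup.zmultiples (g : ZMod n) ↔ (g : ℤ) ∣ β := by
  rw [AddSubgroup.mem_zmultiples_iff]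
  constructor
  · rintro ⟨k, hk⟩
    have h : ((k * g : ℤ) : ZMod n) = (β : ZMod n) := by
      rw [← hk]
      simp
    rw [ZMod.intCast_eq_intCast_iff_dvd_sub] at h
    have := (Int.natCast_dvd_natCast.2 hg).trans h
    exact (dvd_sub_left (Dvd.intro_left k rfl)).1 this
  · rintro ⟨k, rfl⟩
    exact ⟨k, by simp [mul_comm]⟩

lemma range_weightedSumHom {ι : Type*} (n : ℕ) (t : ι → ℕ) (J : Finset ι) :
    (weightedSumHom n t J).range =
      AddSubgroup.zmultiples ((Nat.gcd (J.gcd t) n : ℕ) : ZMod n) := by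
  classical
  apply le_antisymm
  · rintro _ ⟨x, rfl⟩
    rw [weightedSumHom_apply]
    refine AddSubgroup.sum_mem _ fun j _ => ?_
    obtain ⟨c, hc⟩ := (Nat.gcd_dvd_left (J.gcd t) n).trans (Finset.gcd_dvd j.2)
    obtain ⟨z, hz⟩ := ZMod.intCast_surjective (x j)
    rw [hc, ← hz]
    refine AddSubgroup.mem_zmultiples_iff.2 ⟨c * z, ?_⟩
    simp
    ring
  · rw [AddSubgroup.zmultiples_le]
    set H := (weightedSumHom n t J).range.comap (Int.castAddHom (ZMod n)) with hH
    obtain ⟨m, hm⟩ := Int.subgroup_cyclic H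
    have mem (a : ℕ) : m ∣ a ↔ (a : ZMod n) ∈ (weightedSumHom n t J).range := by
      rw [← Int.mem_zmultiples_iff, AddSubgroup.zmultiples_eq_closure, ← hm, hH]
      simp
    rw [← mem, ← Int.natAbs_dvd, Int.natCast_dvd_natCast]
    refine Nat.dvd_gcd (Finset.dvd_gcd fun j hj => ?_) ?_
    · rw [← Int.natCast_dvd_natCast, Int.natAbs_dvd, mem]
      exact ⟨Pi.single ⟨j, hj⟩ 1, by simp [weightedSumHom_apply, Pi.single_apply]⟩
    · rw [← Int.natCast_dvd_natCast, Int.natAbs_dvd, mem]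
      simp

lemma card_fiber_weightedSumHom {ι : Type*} [DecidableEq ι] (n : ℕ) [NeZero n] (t : ι → ℕ) (J : Finset ι)
    (β : ℤ) :
    n * #{x : J → ZMod n | weightedSumHom n t J x = β} =
      if (Nat.gcd (J.gcd t) n : ℤ) ∣ β then n ^ #J * Nat.gcd (J.gcd t) n else 0 := by
  have hn : n ≠ 0 := NeZero.ne n
  have hmem := ZMod.intCast_mem_zmultiples_natCast_iff (Nat.gcd_dvd_right (J.gcd t) n) β
  rw [← range_weightedSumHom] at hmem
  split_ifs with h
  · rw [AddMonoidHom.card_fiber_eq_of_mem_range (weightedSumHom n t J) (hmem.2 h)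
      ⟨0, map_zero _⟩]
    have hker : #{x : J → ZMod n | weightedSumHom n t J x = 0} =
        Nat.card (weightedSumHom n t J).ker := by
      rw [← Fintype.card_subtype, Fintype.card_eq_nat_card]
      rfl
    have hcard := AddSubgroup.card_mul_index (weightedSumHom n t J).ker
    rw [AddSubgroup.index_ker, range_weightedSumHom, Nat.card_zmultiples,
      ZMod.addOrderOf_coe _ hn, ← hker] at hcard
    simp only [Nat.card_eq_fintype_card, Fintype.card_fun, ZMod.card, Fintype.card_coe] at hcard
    rw [← hcard, mul_assoc, Nat.gcd_eq_right (Nat.gcd_dvd_right (J.gcd t) n),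
      Nat.div_mul_cancel (Nat.gcd_dvd_right _ _), mul_comm]
  · rw [Finset.card_eq_zero.2, mul_zero]
    exact Finset.filter_eq_empty_iff.2 fun x _ hx => h (hmem.1 ⟨x, hx⟩)

lemma ZMod.sum_range_natCast {n : ℕ} [NeZero n] {M : Type*} [AddCommMonoid M] (f : ZMod n → M) :
    ∑ i ∈ Finset.range n, f i = ∑ x, f x := by
  refine Finset.sum_bij' (fun i _ => (i : ZMod n)) (fun x _ => x.val) ?_ ?_ ?_ ?_ ?_
  · simp
  · simp [ZMod.val_lt]
  · intro i hi
    exact ZMod.val_cast_of_lt (Finset.mem_range.1 hi)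
  · simp
  · simp

lemma ZMod.sum_range_mul_add_natCast {n : ℕ} [NeZero n] {M : Type*} [AddCommMonoid M]
    (f : ZMod n → M) (k r : ℕ) :
    ∑ i ∈ Finset.range (k * n + r), f i = k • ∑ x, f x + ∑ i ∈ Finset.range r, f i := by
  induction k with
  | zero => simp
  | succ k ih =>
    rw [show (k + 1) * n + r = n + (k * n + r) by ring, Finset.sum_range_add,
      ZMod.sum_range_natCast]
    simp only [Nat.cast_add, CharP.cast_eq_zero, zero_add]
    rw [ih, succ_nsmul', add_assoc]

lemma prod_sum_single {ι κ G : Type*} [Fintype ι] [DecidableEq ι] [AddCommMonoid G]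
    (s : Finset κ) (w : ι → κ → G) :
    ∏ i, ∑ a ∈ s, AddMonoidAlgebra.single (w i a) (1 : ℕ) =
      ∑ a ∈ Fintype.piFinset fun _ : ι => s,
        AddMonoidAlgebra.single (∑ i, w i (a i)) (1 : ℕ) := by
  rw [Finset.prod_univ_sum]
  refine Finset.sum_congr rfl fun a _ => ?_
  exact (map_prod (AddMonoidAlgebra.of ℕ G) (fun i => Multiplicative.ofAdd (w i (a i))) _).symm

lemma latticeCount_eq_coeff {d : ℕ} (n : ℕ) (t : Fin d → ℕ) (α : ℤ) (N : ℕ) :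
    latticeCount n t α N =
      (∏ i, ∑ a ∈ Finset.range N,
        AddMonoidAlgebra.single ((t i : ZMod n) * (a : ZMod n)) (1 : ℕ)).coeff α := by
  rw [prod_sum_single (Finset.range N) fun i (a : ℕ) => (t i : ZMod n) * (a : ZMod n),
    AddMonoidAlgebra.coeff_sum, Finsupp.finsetSum_apply, latticeCount, Finset.card_filter]
  refine Finset.sum_congr rfl fun a _ => ?_
  rw [AddMonoidAlgebra.coeff_single, Finsupp.single_apply]
  congr 1
  rw [← ZMod.intCast_eq_intCast_iff_dvd_sub]
  simp [eq_comm]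

lemma mul_coeff_prod_mul_prod {d : ℕ} (n : ℕ) [NeZero n] (t : Fin d → ℕ) (α : ℤ) (r : ℕ)
    (J : Finset (Fin d)) :
    n * ((∏ i ∈ J, ∑ x : ZMod n, AddMonoidAlgebra.single ((t i : ZMod n) * x) (1 : ℕ)) *
      ∏ i ∈ Jᶜ, ∑ a ∈ Finset.range r,
        AddMonoidAlgebra.single ((t i : ZMod n) * (a : ZMod n)) (1 : ℕ)).coeff α =
      n ^ #J * (gJ n t J * theta n t α J r) := by
  rw [← Finset.prod_coe_sort, Finset.prod_subtype (p := (· ∉ J)) Jᶜ (by simp),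
    prod_sum_single Finset.univ fun (i : J) x => (t i : ZMod n) * x,
    prod_sum_single (Finset.range r) fun (i : {i // i ∉ J}) (a : ℕ) =>
      (t i : ZMod n) * (a : ZMod n), Finset.mul_sum]
  simp only [Finset.sum_mul, AddMonoidAlgebra.single_mul_single, AddMonoidAlgebra.coeff_sum,
    Finsupp.finsetSum_apply, AddMonoidAlgebra.coeff_single, Finsupp.single_apply, mul_one,
    Fintype.piFinset_univ, theta, Finset.card_filter, Finset.mul_sum]
  refine Finset.sum_congr rfl fun a _ => ?_
  have key := card_fiber_weightedSumHom n t J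
    (α - ∑ i : {i // i ∉ J}, (t i.1 : ℤ) * a i)
  rw [Finset.card_filter, Finset.mul_sum] at key
  simp only [gJ, dvd_sub_comm (b := ∑ i : {i // i ∉ J}, (t i.1 : ℤ) * a i)]
  convert key using 3
  · congr 1
    rw [weightedSumHom_apply, ← eq_sub_iff_add_eq]
    simp
  · split_ifs <;> simp

/-- Sort the lattice points by the set `J` of coordinates that are at least `r`. -/
lemma mul_latticeCount {d : ℕ} (n : ℕ) [NeZero n] (t : Fin d → ℕ) (α : ℤ) (k r : ℕ) :
    n * latticeCount n t α (k * n + r) =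
      ∑ i ∈ Finset.range (d + 1), psi n t α i r * (k * n) ^ i := by
  have hsplit (i : Fin d) := ZMod.sum_range_mul_add_natCast
    (fun x : ZMod n => AddMonoidAlgebra.single ((t i : ZMod n) * x) (1 : ℕ)) k r
  simp only [latticeCount_eq_coeff, hsplit, Fintype.prod_add,
    AddMonoidAlgebra.coeff_sum, Finsupp.finsetSum_apply, Finset.mul_sum]
  rw [← Finset.sum_fiberwise_of_maps_to (g := Finset.card) (t := Finset.range (d + 1))
    (fun J _ => Finset.mem_range_succ_iff.2 (by simpa using J.card_le_univ))]
  refine Finset.sum_congr rfl fun i _ => ?_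
  rw [psi, Finset.sum_mul]
  refine Finset.sum_congr rfl fun J hJ => ?_
  obtain rfl := (Finset.mem_filter.1 hJ).2
  have h := mul_coeff_prod_mul_prod n t α r J
  simp only [nsmul_eq_mul, Finset.prod_mul_distrib, Finset.prod_const, mul_assoc]
  rw [← Nat.cast_pow, ← nsmul_eq_mul, AddMonoidAlgebra.coeff_smul, Finsupp.smul_apply,
    smul_eq_mul, mul_left_comm, h, mul_pow]
  ring

/-- Theorem 4.7 of the paper: the lattice point count `|{0,…,N−1}^d ∩ 𝒜^{(α)}|`
equals `∑_{c=0}^d φ_c N^c`, where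
`φ_c = (1/n) ∑_{i=c}^d (−1)^{i−c} binom(i,c) ψ_i^{(α)}(r) r^{i−c}`. -/
theorem stmt0 {d n : ℕ} (hd : 1 ≤ d) (hn : 2 ≤ n) (t : Fin d → ℕ)
    (hgcd : gJ n t Finset.univ = 1) (α : ℤ) (k r N : ℕ)
    (hr0 : 0 < r) (hrn : r < n) (hN : N = k * n + r) :
    (latticeCount n t α N : ℚ) =
      ∑ c ∈ Finset.range (d + 1),
        ((1 / (n : ℚ)) * ∑ i ∈ Finset.Icc c d,
            (-1 : ℚ) ^ (i - c) * (i.choose c : ℚ) * (psi n t α i r : ℚ) * (r : ℚ) ^ (i - c))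
          * (N : ℚ) ^ c := by
  have : NeZero n := ⟨by omega⟩
  have hn0 : (n : ℚ) ≠ 0 := NeZero.ne _
  have h : (n : ℚ) * latticeCount n t α N =
      ∑ i ∈ Finset.range (d + 1), (psi n t α i r : ℚ) * ((N : ℚ) + -r) ^ i := by
    subst hN
    have h := congrArg (Nat.cast (R := ℚ)) (mul_latticeCount n t α k r)
    push_cast at h ⊢
    simpa using h
  rw [eq_div_of_mul_eq hn0 ((mul_comm _ _).trans h), div_eq_inv_mul, ← one_div, Finset.mul_sum]
  simp only [add_pow, Finset.mul_sum, Finset.sum_mul]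
  rw [Finset.sum_sigma', Finset.sum_sigma']
  refine Finset.sum_bij' (fun x _ => ⟨x.2, x.1⟩) (fun x _ => ⟨x.2, x.1⟩) ?_ ?_ ?_ ?_ ?_
  · simp; omega
  · simp; omega
  · simp
  · simp
  · rintro ⟨i, c⟩ -
    rw [neg_pow (r : ℚ)]
    ring
end

section
/- Let 1 ≤ c ≤ d−1. Then the following are equivalent: (i) for every e ∈ ℕ and every i with c ≤ i ≤ d−1 one has φ_i(e) = 0; (ii) g_J = 1 for every subset J ⊆ {1,…,d} of cardinality c. -/
open Finset

theorem gJ_dvd_of_subset {d : ℕ} (n : ℕ) (t : Fin d → ℕ) {I J : Finset (Fin d)} (h : I ⊆ J) :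
    gJ n t J ∣ gJ n t I :=
  Nat.gcd_dvd_gcd_of_dvd_left _ (Finset.gcd_mono h)

theorem gJ_eq_one_of_le_card {d n k : ℕ} {t : Fin d → ℕ}
    (h : ∀ J : Finset (Fin d), J.card = k → gJ n t J = 1)
    {J : Finset (Fin d)} (hJ : k ≤ J.card) : gJ n t J = 1 := by
  obtain ⟨I, hIJ, hI⟩ := Finset.exists_subset_card_eq hJ
  exact Nat.dvd_one.mp (h I hI ▸ gJ_dvd_of_subset n t hIJ)

theorem theta_of_gJ_eq_one {d n : ℕ} {t : Fin d → ℕ} (α : ℤ) {J : Finset (Fin d)}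
    (h : gJ n t J = 1) (r : ℕ) : theta n t α J r = r ^ (d - J.card) := by
  unfold theta
  rw [Finset.filter_true_of_mem (by simp [h])]
  simp [Fintype.card_piFinset, Fintype.card_subtype_compl]

theorem theta_zero_one {d : ℕ} (n : ℕ) (t : Fin d → ℕ) (J : Finset (Fin d)) :
    theta n t 0 J 1 = 1 := by
  unfold theta
  rw [Finset.filter_true_of_mem]
  · simp
  · intro a ha
    have h0 : a = fun _ => 0 := by simpa using ha
    simp [h0]

theorem psi_of_gJ_eq_one {d n i : ℕ} {t : Fin d → ℕ} (α : ℤ)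
    (h : ∀ J : Finset (Fin d), J.card = i → gJ n t J = 1) (r : ℕ) :
    psi n t α i r = d.choose i * r ^ (d - i) := by
  unfold psi
  rw [Finset.sum_congr rfl (g := fun _ => r ^ (d - i))]
  · simp [← Finset.powerset_univ, ← Finset.powersetCard_eq_filter]
  · intro J hJ
    have hJ' : J.card = i := by simpa using hJ
    rw [theta_of_gJ_eq_one α (h J hJ'), h J hJ', hJ', one_mul]

theorem gJ_eq_one_of_psi_zero_one {d n i : ℕ} {t : Fin d → ℕ} (hn : 0 < n)
    (h : psi n t 0 i 1 = d.choose i) (J : Finset (Fin d)) (hJ : J.card = i) :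
    gJ n t J = 1 := by
  have hpos : ∀ I ∈ Finset.univ.filter (fun I : Finset (Fin d) => I.card = i),
      1 ≤ gJ n t I := fun I _ => Nat.gcd_pos_of_pos_right _ hn
  have hsum : ∑ I ∈ Finset.univ.filter (fun I : Finset (Fin d) => I.card = i), 1 =
      ∑ I ∈ Finset.univ.filter (fun I : Finset (Fin d) => I.card = i), gJ n t I := by
    rw [psi] at h
    simp only [theta_zero_one, mul_one] at h
    rw [h]
    simp [← Finset.powerset_univ, ← Finset.powersetCard_eq_filter]
  exact ((Finset.sum_eq_sum_iff_of_le hpos).mp hsum J (by simp [hJ])).symm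

theorem alternating_sum_choose_mul_choose {d i : ℕ} (hi : i < d) :
    ∑ k ∈ Finset.Icc i d, (-1 : ℚ) ^ (k - i) * (k.choose i : ℚ) * (d.choose k : ℚ) = 0 := by
  have h := Int.alternating_sum_range_choose_of_ne (n := d - i) (by omega)
  have hQ : ∑ m ∈ Finset.range (d - i + 1), (-1 : ℚ) ^ m * ((d - i).choose m : ℚ) = 0 := by
    exact_mod_cast h
  rw [← Finset.Ico_add_one_right_eq_Icc, Finset.sum_Ico_eq_sum_range,
    show d + 1 - i = d - i + 1 by omega, ← mul_zero (d.choose i : ℚ), ← hQ, Finset.mul_sum]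
  refine Finset.sum_congr rfl fun m hm => ?_
  have hm' : i + m ≤ d := by have := Finset.mem_range.mp hm; omega
  have hc := Nat.choose_mul (n := d) (k := i + m) (s := i) (by omega)
  rw [Nat.add_sub_cancel_left] at hc ⊢
  have hcQ : (d.choose (i + m) : ℚ) * ((i + m).choose i : ℚ) =
      (d.choose i : ℚ) * ((d - i).choose m : ℚ) := by exact_mod_cast hc
  linear_combination (-1 : ℚ) ^ m * hcQ

/-- If `gJ = 1` above level `i`, the alternating sum of the `psi` collapses to the deviation of
`psi i` from its value for the trivial group. -/
theorem alternating_sum_psi {d n i : ℕ} {t : Fin d → ℕ} (α : ℤ) (hi : i < d)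
    (h : ∀ J : Finset (Fin d), J.card = i + 1 → gJ n t J = 1) (r : ℕ) :
    ∑ k ∈ Finset.Icc i d, (-1 : ℚ) ^ (k - i) * (k.choose i : ℚ) * (psi n t α k r : ℚ)
        * (r : ℚ) ^ (k - i) =
      (psi n t α i r : ℚ) - (d.choose i : ℚ) * (r : ℚ) ^ (d - i) := by
  have h0 := congrArg (· * (r : ℚ) ^ (d - i)) (alternating_sum_choose_mul_choose hi)
  simp only [zero_mul, Finset.sum_mul] at h0
  rw [← sub_zero (∑ k ∈ Finset.Icc i d, _), ← h0, ← Finset.sum_sub_distrib,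
    ← Finset.add_sum_Ioc_eq_sum_Icc hi.le, Finset.sum_eq_zero]
  · simp
  · intro k hk
    obtain ⟨hik, hkd⟩ := Finset.mem_Ioc.mp hk
    rw [psi_of_gJ_eq_one α fun J hJ => gJ_eq_one_of_le_card (J := J) h (by omega),
      show d - i = (d - k) + (k - i) by omega, pow_add]
    push_cast
    ring

/-- Theorem 4.10 of the paper: for `1 ≤ c ≤ d−1`, the coefficients
`φ_c, …, φ_{d−1}` of the F-signature quasi-polynomial of the cyclic quotient
singularity `1/n(t₁,…,t_d)` vanish identically if and only if `g_J = 1` for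
every subset `J` of cardinality `c`.  Here `r_e = p^e % n` and
`φ_c(e) = (1/n) ∑_{i=c}^d (−1)^{i−c} binom(i,c) ψ_i^{(0)}(r_e) r_e^{i−c}`. -/
theorem stmt1 {d n p : ℕ} (hd : 2 ≤ d) (hn : 2 ≤ n) (hp : 2 ≤ p)
    (hpn : Nat.gcd p n = 1) (t : Fin d → ℕ)
    (hsmall : ∀ J : Finset (Fin d), J.card = d - 1 → gJ n t J = 1)
    (φ : ℕ → ℕ → ℚ)
    (hφ : ∀ c e, φ c e = (1 / (n : ℚ)) * ∑ i ∈ Finset.Icc c d,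
        (-1 : ℚ) ^ (i - c) * (i.choose c : ℚ) * (psi n t 0 i (p ^ e % n) : ℚ)
          * ((p ^ e % n : ℕ) : ℚ) ^ (i - c))
    (c : ℕ) (hc1 : 1 ≤ c) (hcd : c ≤ d - 1) :
    (∀ e i, c ≤ i → i ≤ d - 1 → φ i e = 0) ↔
      (∀ J : Finset (Fin d), J.card = c → gJ n t J = 1) := by
  have hn0 : (n : ℚ) ≠ 0 := by exact_mod_cast (by omega : n ≠ 0)
  have hφ' : ∀ i e, i < d → (∀ J : Finset (Fin d), J.card = i + 1 → gJ n t J = 1) →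
      (φ i e = 0 ↔ psi n t 0 i (p ^ e % n) = d.choose i * (p ^ e % n) ^ (d - i)) := by
    intro i e hi h
    rw [hφ, alternating_sum_psi 0 hi h, mul_eq_zero_iff_left (one_div_ne_zero hn0), sub_eq_zero]
    norm_cast
  constructor
  · intro h
    refine Nat.decreasingInduction' (P := fun i => ∀ J : Finset (Fin d), J.card = i → gJ n t J = 1)
      (fun i hi hci ih => ?_) hcd hsmall
    have hpsi := (hφ' i 0 (by omega) ih).mp (h 0 i hci hi.le)
    rw [pow_zero, Nat.mod_eq_of_lt (by omega), one_pow, mul_one] at hpsi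
    exact gJ_eq_one_of_psi_zero_one (by omega) hpsi
  · intro h e i hci hid
    exact (hφ' i e (by omega) fun J hJ => gJ_eq_one_of_le_card (J := J) h (by omega)).mpr
      (psi_of_gJ_eq_one 0 (fun J hJ => gJ_eq_one_of_le_card (J := J) h (by omega)) _)
end

section
/- Let 0 ≤ ℓ < d, and assume that φ_i(e) = 0 for every e ∈ ℕ and every i with ℓ < i ≤ d−1. Then for every e ∈ ℕ one has φ_ℓ(e) = (−binom(d,ℓ) · r_e^{d−ℓ} + ψ_ℓ^{(0)}(r_e)) / n. -/
open Finset

/-- The coefficients of a Taylor shift, as sums over the exponents up to a degree bound. -/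
theorem Polynomial.taylor_coeff_eq_sum_Icc {R : Type*} [CommRing R] {f : Polynomial R} {d : ℕ}
    (hf : f.natDegree ≤ d) (x : R) (c : ℕ) :
    (Polynomial.taylor x f).coeff c =
      ∑ i ∈ Finset.Icc c d, (i.choose c : R) * f.coeff i * x ^ (i - c) := by
  rw [Polynomial.taylor_coeff, Polynomial.hasseDeriv_apply,
    Polynomial.sum_over_range' f (by simp) (d + 1) (Nat.lt_succ_of_le hf),
    Polynomial.eval_finsetSum]
  symm
  simp only [Polynomial.eval_monomial]
  apply Finset.sum_subset
  · intro i hi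
    simp only [Finset.mem_Icc, Finset.mem_range] at hi ⊢
    omega
  · intro i hi hi'
    simp only [Finset.mem_Icc, Finset.mem_range] at hi hi'
    rw [Nat.choose_eq_zero_of_lt (by omega)]
    simp

/-- Binomial inversion for the passage from `a` to its Taylor shift by `-x`. -/
theorem eq_sum_choose_mul_of_eq_sum_neg_one_pow {R : Type*} [CommRing R] {d : ℕ} (a b : ℕ → R)
    (x : R)
    (hb : ∀ c, b c = ∑ i ∈ Finset.Icc c d, (-1 : R) ^ (i - c) * (i.choose c : R) * a i * x ^ (i - c))
    {c : ℕ} (hc : c ≤ d) :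
    a c = ∑ i ∈ Finset.Icc c d, (i.choose c : R) * b i * x ^ (i - c) := by
  set f : Polynomial R := ∑ i ∈ Finset.range (d + 1), Polynomial.monomial i (a i) with hf
  have hcoeff : ∀ i ≤ d, f.coeff i = a i := fun i hi => by
    simp [hf, Polynomial.coeff_monomial, Nat.lt_succ_of_le hi]
  have hdeg : f.natDegree ≤ d :=
    Polynomial.natDegree_sum_le_of_forall_le _ _ fun i hi =>
      (Polynomial.natDegree_monomial_le _).trans (Nat.lt_succ_iff.mp (Finset.mem_range.mp hi))
  have hshift : ∀ i, (Polynomial.taylor (-x) f).coeff i = b i := fun i => by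
    rw [Polynomial.taylor_coeff_eq_sum_Icc hdeg, hb]
    refine Finset.sum_congr rfl fun j hj => ?_
    rw [hcoeff j (Finset.mem_Icc.mp hj).2, neg_pow x]
    ring
  have hinv : Polynomial.taylor x (Polynomial.taylor (-x) f) = f := by
    rw [Polynomial.taylor_taylor]
    simp
  rw [← hcoeff c hc, ← hinv,
    Polynomial.taylor_coeff_eq_sum_Icc (d := d) (by rwa [Polynomial.natDegree_taylor])]
  simp only [hshift]

theorem theta_univ_of_gJ_eq_one {d n : ℕ} {t : Fin d → ℕ} (h : gJ n t Finset.univ = 1) (α : ℤ)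
    (r : ℕ) : theta n t α Finset.univ r = 1 := by
  have : IsEmpty {ℓ : Fin d // ℓ ∉ (Finset.univ : Finset (Fin d))} :=
    ⟨fun ℓ => ℓ.2 (Finset.mem_univ _)⟩
  simp [theta, h]

theorem psi_self_of_gJ_eq_one {d n : ℕ} {t : Fin d → ℕ} (h : gJ n t Finset.univ = 1) (α : ℤ)
    (r : ℕ) : psi n t α d r = 1 := by
  have hfilter : Finset.univ.filter (fun J : Finset (Fin d) => J.card = d) = {Finset.univ} := by
    ext J
    simpa using Finset.card_eq_iff_eq_univ J
  rw [psi, hfilter, Finset.sum_singleton, h, theta_univ_of_gJ_eq_one h]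

/-- Theorem 4.10 of the paper (second part): if `φ_ℓ` is such that all higher
coefficients `φ_i` with `ℓ < i ≤ d−1` vanish identically, then for all `e`,
`φ_ℓ(e) = (−binom(d,ℓ) r_e^{d−ℓ} + ψ_ℓ^{(0)}(r_e)) / n`, where `r_e = p^e % n`
and `φ_c(e) = (1/n) ∑_{i=c}^d (−1)^{i−c} binom(i,c) ψ_i^{(0)}(r_e) r_e^{i−c}`. -/
theorem stmt2 {d n p : ℕ} (hd : 2 ≤ d) (hn : 2 ≤ n) (hp : 2 ≤ p)
    (hpn : Nat.gcd p n = 1) (t : Fin d → ℕ)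
    (hsmall : ∀ J : Finset (Fin d), J.card = d - 1 → gJ n t J = 1)
    (φ : ℕ → ℕ → ℚ)
    (hφ : ∀ c e, φ c e = (1 / (n : ℚ)) * ∑ i ∈ Finset.Icc c d,
        (-1 : ℚ) ^ (i - c) * (i.choose c : ℚ) * (psi n t 0 i (p ^ e % n) : ℚ)
          * ((p ^ e % n : ℕ) : ℚ) ^ (i - c))
    (ℓ : ℕ) (hℓ : ℓ < d)
    (hvanish : ∀ e i, ℓ < i → i ≤ d - 1 → φ i e = 0) :
    ∀ e, φ ℓ e = (-(d.choose ℓ : ℚ) * ((p ^ e % n : ℕ) : ℚ) ^ (d - ℓ)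
        + (psi n t 0 ℓ (p ^ e % n) : ℚ)) / (n : ℚ) := by
  have hn0 : (n : ℚ) ≠ 0 := by positivity
  obtain ⟨J, -, hJ⟩ := Finset.exists_subset_card_eq
    (s := (Finset.univ : Finset (Fin d))) (n := d - 1) (by simp)
  have hg : gJ n t Finset.univ = 1 :=
    Nat.dvd_one.mp (hsmall J hJ ▸ gJ_dvd_of_subset n t (Finset.subset_univ J))
  intro e
  have hscaled : ∀ c, (n : ℚ) * φ c e = ∑ i ∈ Finset.Icc c d, (-1 : ℚ) ^ (i - c) *
      (i.choose c : ℚ) * (psi n t 0 i (p ^ e % n) : ℚ) * ((p ^ e % n : ℕ) : ℚ) ^ (i - c) :=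
    fun c => by rw [hφ, ← mul_assoc, mul_one_div_cancel hn0, one_mul]
  have htop : (n : ℚ) * φ d e = 1 := by
    rw [hscaled]
    simp [psi_self_of_gJ_eq_one hg]
  have hinv := eq_sum_choose_mul_of_eq_sum_neg_one_pow
    (fun i => (psi n t 0 i (p ^ e % n) : ℚ)) (fun c => (n : ℚ) * φ c e) _ hscaled hℓ.le
  rw [Finset.sum_eq_add_of_mem ℓ d (by simp [hℓ.le]) (by simp [hℓ.le]) hℓ.ne] at hinv
  · simp only [htop, Nat.choose_self, Nat.sub_self, pow_zero] at hinv
    rw [hinv]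
    field_simp
    ring
  · intro i hi hne
    rw [Finset.mem_Icc] at hi
    rw [hvanish e i (by omega) (by omega)]
    simp
end

section
/- Let N = kn + r with integers k ≥ 0 and 0 < r < n. Then n times the number of lattice points in ({0,…,N−1}^d) ∩ 𝒜^{(α)} equals ∑_{i=0}^{d} (kn)^i · ψ_i^{(α)}(r). -/
open Finset

/-- A full geometric sum over the powers of an `n`-th root of unity. -/
lemma sum_pow_range_of_pow_eq_one {z : ℂ} {n : ℕ} (hz : z ^ n = 1) :
    ∑ a ∈ range n, z ^ a = if z = 1 then (n : ℂ) else 0 := by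
  split_ifs with h
  · simp [h]
  · rw [geom_sum_eq h, hz, sub_self, zero_div]

lemma sum_pow_range_mul_add {z : ℂ} {n : ℕ} (hz : z ^ n = 1) (k r : ℕ) :
    ∑ a ∈ range (k * n + r), z ^ a =
      (if z = 1 then ((k * n : ℕ) : ℂ) else 0) + ∑ a ∈ range r, z ^ a := by
  induction k with
  | zero => simp
  | succ k ih =>
    rw [show (k + 1) * n + r = n + (k * n + r) by ring, sum_range_add]
    simp only [pow_add, hz, one_mul, ih, sum_pow_range_of_pow_eq_one hz]
    split_ifs <;> push_cast <;> ring

/-- Orthogonality on the subgroup of characters of `ℤ/nℤ` that are trivial on `g`. -/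
lemma sum_zpow_filter_dvd {ζ : ℂ} {n g : ℕ} (hn : 0 < n) (hζ : IsPrimitiveRoot ζ n)
    (hg : g ∣ n) (m : ℤ) :
    ∑ c ∈ range n with n ∣ c * g, ζ ^ ((c : ℤ) * m) = if (g : ℤ) ∣ m then (g : ℂ) else 0 := by
  obtain ⟨q, rfl⟩ := hg
  have hg0 : 0 < g := Nat.pos_of_mul_pos_right hn
  have hq0 : 0 < q := Nat.pos_of_mul_pos_left hn
  have hset : (range (g * q)).filter (fun c => g * q ∣ c * g) = (range g).image (q * ·) := by
    ext c
    simp only [mem_filter, mem_range, mem_image]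
    rw [mul_comm c g, Nat.mul_dvd_mul_iff_left hg0]
    constructor
    · rintro ⟨hc, j, rfl⟩
      rw [mul_comm g q] at hc
      exact ⟨j, Nat.lt_of_mul_lt_mul_left hc, rfl⟩
    · rintro ⟨j, hj, rfl⟩
      exact ⟨by rw [mul_comm g q]; exact Nat.mul_lt_mul_of_pos_left hj hq0, dvd_mul_right q j⟩
  have hpow (j : ℕ) : ζ ^ (((q * j : ℕ) : ℤ) * m) = (ζ ^ ((q : ℤ) * m)) ^ j := by
    rw [← zpow_natCast, ← zpow_mul]
    congr 1
    push_cast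
    ring
  have hone : (ζ ^ ((q : ℤ) * m)) ^ g = 1 := by
    rw [← zpow_natCast, ← zpow_mul, hζ.zpow_eq_one_iff_dvd]
    exact ⟨m, by push_cast; ring⟩
  have hiff : ζ ^ ((q : ℤ) * m) = 1 ↔ (g : ℤ) ∣ m := by
    rw [hζ.zpow_eq_one_iff_dvd, Nat.cast_mul, mul_comm (g : ℤ),
      mul_dvd_mul_iff_left (by exact_mod_cast hq0.ne')]
  rw [hset, sum_image fun x _ y _ h => Nat.eq_of_mul_eq_mul_left hq0 h]
  simp only [hpow, sum_pow_range_of_pow_eq_one hone, hiff]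

/-- Counting solutions of a linear congruence modulo `g ∣ n` in a box by a character sum. -/
lemma mul_card_filter_dvd_eq_sum {ι : Type*} [Fintype ι] [DecidableEq ι] {ζ : ℂ} {n g : ℕ}
    (hn : 0 < n) (hζ : IsPrimitiveRoot ζ n) (hg : g ∣ n) (t : ι → ℕ) (α : ℤ) (r : ℕ) :
    (g : ℂ) * (((Fintype.piFinset fun _ : ι => range r).filter
        fun a => (g : ℤ) ∣ (∑ ℓ, (t ℓ : ℤ) * a ℓ) - α).card : ℂ) =
      ∑ c ∈ range n with n ∣ c * g,
        ζ ^ (-((c : ℤ) * α)) * ∏ ℓ, ∑ a ∈ range r, (ζ ^ (c * t ℓ)) ^ a := by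
  have hζ0 : ζ ≠ 0 := hζ.ne_zero hn.ne'
  have hterm (c : ℕ) (a : ι → ℕ) :
      ζ ^ (-((c : ℤ) * α)) * ∏ ℓ, (ζ ^ (c * t ℓ)) ^ a ℓ =
        ζ ^ ((c : ℤ) * ((∑ ℓ, (t ℓ : ℤ) * a ℓ) - α)) := by
    simp only [← pow_mul]
    rw [prod_pow_eq_pow_sum, ← zpow_natCast, ← zpow_add₀ hζ0]
    congr 1
    push_cast
    rw [mul_sub, mul_sum]
    simp only [mul_assoc]
    ring
  simp only [prod_univ_sum, mul_sum, hterm]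
  rw [sum_comm]
  simp only [sum_zpow_filter_dvd hn hζ hg]
  rw [← sum_filter, sum_const, nsmul_eq_mul, mul_comm]

lemma dvd_mul_gJ_iff {d n : ℕ} (t : Fin d → ℕ) (J : Finset (Fin d)) (c : ℕ) :
    n ∣ c * gJ n t J ↔ ∀ j ∈ J, n ∣ c * t j := by
  rw [gJ, ← Nat.gcd_mul_left, Nat.dvd_gcd_iff, and_iff_left (dvd_mul_left n c)]
  have h : c * J.gcd t = J.gcd fun j => c * t j := by
    rw [Finset.gcd_mul_left, normalize_eq]
  rw [h, Finset.dvd_gcd_iff]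

/-- The key counting identity in the proof of Theorem 4.7 of the paper:
for `N = kn + r` with `0 < r < n`,
`n · |{0,…,N−1}^d ∩ 𝒜^{(α)}| = ∑_{i=0}^d (kn)^i ψ_i^{(α)}(r)`. -/
theorem stmt3 {d n : ℕ} (hd : 1 ≤ d) (hn : 2 ≤ n) (t : Fin d → ℕ)
    (hgcd : gJ n t Finset.univ = 1) (α : ℤ) (k r N : ℕ)
    (hr0 : 0 < r) (hrn : r < n) (hN : N = k * n + r) :
    n * latticeCount n t α N =
      ∑ i ∈ Finset.range (d + 1), (k * n) ^ i * psi n t α i r := by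
  have hn0 : 0 < n := by omega
  obtain ⟨ζ, hζ⟩ : ∃ ζ : ℂ, IsPrimitiveRoot ζ n := ⟨_, Complex.isPrimitiveRoot_exp n hn0.ne'⟩
  have hrhs : ∑ i ∈ range (d + 1), (k * n) ^ i * psi n t α i r =
      ∑ J : Finset (Fin d), (k * n) ^ J.card * (gJ n t J * theta n t α J r) := by
    rw [← sum_fiberwise_of_maps_to (s := univ) (t := range (d + 1)) (g := Finset.card)
      fun J _ => mem_range.2 (Nat.lt_succ_of_le (card_finset_fin_le J))]
    refine sum_congr rfl fun i _ => ?_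
    rw [psi, mul_sum]
    refine sum_congr rfl fun J hJ => ?_
    rw [(mem_filter.1 hJ).2]
  have hroot (c : ℕ) : (ζ ^ c) ^ n = 1 := by rw [pow_right_comm, hζ.pow_eq_one, one_pow]
  rw [hrhs, ← Nat.cast_inj (R := ℂ), Nat.cast_mul, latticeCount,
    mul_card_filter_dvd_eq_sum hn0 hζ dvd_rfl, filter_true_of_mem fun c _ => dvd_mul_left n c, hN]
  simp only [sum_pow_range_mul_add (hroot _), hζ.pow_eq_one_iff_dvd, prod_add, powerset_univ,
    mul_sum]
  rw [sum_comm, Nat.cast_sum]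
  refine sum_congr rfl fun J _ => ?_
  rw [Nat.cast_mul (_ ^ _), Nat.cast_mul (gJ n t J), theta,
    mul_card_filter_dvd_eq_sum (g := gJ n t J) hn0 hζ (Nat.gcd_dvd_right _ _), mul_sum, sum_filter]
  refine sum_congr rfl fun c _ => ?_
  simp only [dvd_mul_gJ_iff]
  rw [prod_ite_zero, prod_const, prod_subtype (univ \ J) (p := fun ℓ => ℓ ∉ J) (by simp)]
  split_ifs
  · push_cast
    ring
  · simp
end

section
/- Let d ≥ 1, n ≥ 1 and let N = kn + r with integers k ≥ 0 and 0 < r < n. Then the box {0,…,N−1}^d is the disjoint union, over all subsets J ⊆ {1,…,d} and all functions s : J → {0,…,k−1}, of the translates C_J + n·v_{J,s}; that is, these translates are pairwise disjoint and their union is {0,…,N−1}^d. -/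
open Finset

/-- The translate `C_J + n·v_{J,s}` of the box
`C_J = {a ∈ ℤ^d : 0 ≤ a_j ≤ n−1 for j ∈ J, 0 ≤ a_j ≤ r−1 for j ∉ J}`,
where `v_{J,s}(j) = s(j)` for `j ∈ J` and `v_{J,s}(j) = k` for `j ∉ J`. -/
def tile {d : ℕ} (n r k : ℕ) (J : Finset (Fin d)) (s : {x : Fin d // x ∈ J} → ℕ) :
    Finset (Fin d → ℕ) :=
  Fintype.piFinset fun j =>
    Finset.Ico (n * (if h : j ∈ J then s ⟨j, h⟩ else k))
      (n * (if h : j ∈ J then s ⟨j, h⟩ else k) + if j ∈ J then n else r)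

theorem mem_tile {d n r k : ℕ} {J : Finset (Fin d)} {s : {x : Fin d // x ∈ J} → ℕ}
    {a : Fin d → ℕ} :
    a ∈ tile n r k J s ↔
      (∀ j (h : j ∈ J), n * s ⟨j, h⟩ ≤ a j ∧ a j < n * s ⟨j, h⟩ + n) ∧
        ∀ j, j ∉ J → n * k ≤ a j ∧ a j < n * k + r := by
  simp only [tile, Fintype.mem_piFinset, Finset.mem_Ico]
  constructor
  · intro H
    exact ⟨fun j h => by simpa [h] using H j, fun j h => by simpa [h] using H j⟩
  · rintro ⟨H₁, H₂⟩ j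
    by_cases h : j ∈ J
    · simpa [h] using H₁ j h
    · simpa [h] using H₂ j h

theorem div_eq_of_mem_tile {d n r k : ℕ} {J : Finset (Fin d)} {s : {x : Fin d // x ∈ J} → ℕ}
    {a : Fin d → ℕ} (ha : a ∈ tile n r k J s) (x : {x : Fin d // x ∈ J}) :
    a x / n = s x := by
  obtain ⟨h₁, h₂⟩ := (mem_tile.1 ha).1 x x.2
  exact Nat.div_eq_of_lt_le (by rwa [mul_comm]) (by rwa [add_mul, one_mul, mul_comm])

theorem mem_iff_of_mem_tile {d n r k : ℕ} {J : Finset (Fin d)}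
    {s : {x : Fin d // x ∈ J} → ℕ} {a : Fin d → ℕ} (hs : ∀ x, s x < k)
    (ha : a ∈ tile n r k J s) (j : Fin d) : j ∈ J ↔ a j < n * k := by
  by_cases h : j ∈ J
  · have h₁ := ((mem_tile.1 ha).1 j h).2
    have h₂ : n * (s ⟨j, h⟩ + 1) ≤ n * k := Nat.mul_le_mul_left n (hs ⟨j, h⟩)
    rw [mul_add, mul_one] at h₂
    exact iff_of_true h (h₁.trans_le h₂)
  · exact iff_of_false h (((mem_tile.1 ha).2 j h).1.not_gt)

/-- Lemma 4.4 of the paper: for `N = kn + r` with `0 < r < n`, the box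
`{0,…,N−1}^d` is the disjoint union, over all subsets `J ⊆ {1,…,d}` and all
functions `s : J → {0,…,k−1}`, of the translates `C_J + n·v_{J,s}`: each
translate is contained in the box, every point of the box lies in one of them,
and distinct translates are disjoint. -/
theorem stmt5 (d n k r N : ℕ) (hd : 1 ≤ d) (hn : 1 ≤ n)
    (hr0 : 0 < r) (hrn : r < n) (hN : N = k * n + r) :
    (∀ (J : Finset (Fin d)) (s : {x : Fin d // x ∈ J} → ℕ), (∀ x, s x < k) →
        tile n r k J s ⊆ Fintype.piFinset fun _ : Fin d => Finset.range N) ∧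
      (∀ a ∈ (Fintype.piFinset fun _ : Fin d => Finset.range N),
        ∃ (J : Finset (Fin d)) (s : {x : Fin d // x ∈ J} → ℕ),
          (∀ x, s x < k) ∧ a ∈ tile n r k J s) ∧
      (∀ P Q : Σ J : Finset (Fin d), {x : Fin d // x ∈ J} → ℕ,
        (∀ x, P.2 x < k) → (∀ x, Q.2 x < k) → P ≠ Q →
          Disjoint (tile n r k P.1 P.2) (tile n r k Q.1 Q.2)) := by
  subst hN
  refine ⟨fun J s hs a ha => ?_, fun a ha => ?_, ?_⟩
  · simp only [Fintype.mem_piFinset, Finset.mem_range]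
    intro j
    rw [mul_comm k n]
    by_cases h : j ∈ J
    · exact ((mem_iff_of_mem_tile hs ha j).1 h).trans_le (Nat.le_add_right _ _)
    · exact ((mem_tile.1 ha).2 j h).2
  · simp only [Fintype.mem_piFinset, Finset.mem_range] at ha
    refine ⟨Finset.univ.filter fun j => a j < n * k, fun x => a x / n, fun x => ?_,
      mem_tile.2 ⟨fun j _ => ⟨Nat.mul_div_le _ _, ?_⟩, fun j h => ⟨?_, ?_⟩⟩⟩
    · exact Nat.div_lt_of_lt_mul (Finset.mem_filter.1 x.2).2
    · exact Nat.lt_mul_div_succ (a j) hn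
    · simpa using h
    · rw [mul_comm n k]
      exact ha j
  · rintro ⟨J, s⟩ ⟨K, t⟩ hs ht hne
    refine Finset.disjoint_left.2 fun a ha hb => hne ?_
    obtain rfl : J = K := Finset.ext fun j =>
      (mem_iff_of_mem_tile hs ha j).trans (mem_iff_of_mem_tile ht hb j).symm
    obtain rfl : s = t := funext fun x =>
      (div_eq_of_mem_tile ha x).symm.trans (div_eq_of_mem_tile hb x)
    rfl
end

section
/- Assume gcd(t_ℓ, n) = 1 for every ℓ ∈ {1,…,d}. Let N = kn + r with integers k ≥ 0 and 0 < r < n. Then n times the number of lattice points in ({0,…,N−1}^d) ∩ 𝒜^{(α)} equals N^d − r^d + n · θ_∅^{(α)}(r); equivalently, the count is (N^d − r^d)/n + θ_∅^{(α)}(r). -/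
open Finset

/-- The number of `a ∈ {0,…,N−1}^d` with `∑ u_ℓ a_ℓ = β` in `ℤ/nℤ`. -/
def boxResidueCount {d n : ℕ} (u : Fin d → ZMod n) (N : ℕ) (β : ZMod n) : ℕ :=
  ((Fintype.piFinset fun _ : Fin d => Finset.range N).filter
    fun a => ∑ ℓ, u ℓ * (a ℓ : ZMod n) = β).card

theorem boxResidueCount_succ {d n : ℕ} (u : Fin (d + 1) → ZMod n) (N : ℕ) (β : ZMod n) :
    boxResidueCount u N β =
      ∑ x ∈ range N, boxResidueCount (fun i => u i.succ) N (β - u 0 * (x : ZMod n)) := by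
  unfold boxResidueCount
  rw [card_eq_sum_card_fiberwise (f := fun a => a 0) (t := range N)
    (fun a ha => by
      simp only [coe_filter, Fintype.mem_piFinset, Set.mem_ofPred_eq] at ha
      exact ha.1 0)]
  refine sum_congr rfl fun x hx => ?_
  refine card_nbij' (fun a i => a i.succ) (fun b => Fin.cons x b) ?_ ?_ ?_ ?_
  · intro a ha
    simp only [coe_filter, mem_filter, Fintype.mem_piFinset, Set.mem_ofPred_eq,
      Fin.sum_univ_succ] at ha ⊢
    obtain ⟨⟨h, rfl⟩, rfl⟩ := ha
    exact ⟨fun i => h i.succ, by ring⟩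
  · intro b hb
    simp only [coe_filter, mem_filter, Fintype.mem_piFinset, Set.mem_ofPred_eq,
      Fin.sum_univ_succ, Fin.cons_zero, Fin.cons_succ] at hb ⊢
    refine ⟨⟨Fin.cases hx hb.1, ?_⟩, trivial⟩
    rw [hb.2]
    ring
  · intro a ha
    simp only [coe_filter, mem_filter, Set.mem_ofPred_eq] at ha
    obtain ⟨-, rfl⟩ := ha
    exact Fin.cons_self_tail a
  · intro b _
    rfl

theorem sum_boxResidueCount {d n : ℕ} [NeZero n] (u : Fin d → ZMod n) (N : ℕ) :
    ∑ β, boxResidueCount u N β = N ^ d := by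
  unfold boxResidueCount
  rw [← card_eq_sum_card_fiberwise fun _ _ => mem_coe.2 (mem_univ _)]
  simp

theorem sum_range_natCast_zmod {n : ℕ} [NeZero n] {M : Type*} [AddCommMonoid M]
    (f : ZMod n → M) : ∑ x ∈ range n, f x = ∑ β, f β := by
  refine sum_nbij' (fun x => (x : ZMod n)) ZMod.val ?_ ?_ ?_ ?_ ?_
  · simp
  · intro β _
    simpa using ZMod.val_lt β
  · intro x hx
    exact ZMod.val_cast_of_lt (mem_range.1 hx)
  · simp
  · simp

theorem sum_range_mul_add_zmod {n : ℕ} [NeZero n] {M : Type*} [AddCommMonoid M]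
    (f : ZMod n → M) (k r : ℕ) :
    ∑ x ∈ range (k * n + r), f x = k • ∑ β, f β + ∑ x ∈ range r, f x := by
  rw [sum_range_add]
  congr 1
  · induction k with
    | zero => simp
    | succ k ih =>
      rw [Nat.succ_mul, sum_range_add, ih, succ_nsmul]
      simp [sum_range_natCast_zmod]
  · simp

theorem sum_sub_unit_mul {n : ℕ} [NeZero n] {M : Type*} [AddCommMonoid M]
    (f : ZMod n → M) {u : ZMod n} (hu : IsUnit u) (β : ZMod n) :
    ∑ x, f (β - u * x) = ∑ x, f x := by
  obtain ⟨v, rfl⟩ := hu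
  exact Fintype.sum_equiv (v.mulLeft.trans (Equiv.subLeft β)) _ _ fun _ => rfl

/-- The deviation of the residue count from equidistribution depends only on `N` modulo `n`. -/
theorem mul_boxResidueCount_sub_pow {d n : ℕ} [NeZero n] (u : Fin d → ZMod n)
    (hu : ∀ i, IsUnit (u i)) (k r : ℕ) (β : ZMod n) :
    (n : ℤ) * boxResidueCount u (k * n + r) β - ((k * n + r : ℕ) : ℤ) ^ d =
      n * boxResidueCount u r β - (r : ℤ) ^ d := by
  induction d generalizing β with
  | zero => simp [boxResidueCount]
  | succ d ih =>
    have deviation_succ (N : ℕ) : (n : ℤ) * boxResidueCount u N β - (N : ℤ) ^ (d + 1) =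
        ∑ x ∈ range N, ((n : ℤ) *
          boxResidueCount (fun i => u i.succ) N (β - u 0 * (x : ZMod n)) - (N : ℤ) ^ d) := by
      rw [boxResidueCount_succ, sum_sub_distrib, ← mul_sum]
      simp [pow_succ']
    have deviation_sum : ∑ γ, ((n : ℤ) * boxResidueCount (fun i => u i.succ) r γ
        - (r : ℤ) ^ d) = 0 := by
      rw [sum_sub_distrib, ← mul_sum, ← Nat.cast_sum, sum_boxResidueCount]
      simp
    rw [deviation_succ, deviation_succ]
    simp_rw [ih (fun i => u i.succ) fun i => hu i.succ]
    rw [sum_range_mul_add_zmod (fun x => (n : ℤ) *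
        boxResidueCount (fun i => u i.succ) r (β - u 0 * x) - (r : ℤ) ^ d),
      sum_sub_unit_mul (fun γ => (n : ℤ) *
        boxResidueCount (fun i => u i.succ) r γ - (r : ℤ) ^ d) (hu 0),
      deviation_sum, smul_zero, zero_add]

theorem latticeCount_eq_boxResidueCount {d n : ℕ} (t : Fin d → ℕ) (α : ℤ) (N : ℕ) :
    latticeCount n t α N = boxResidueCount (fun ℓ => (t ℓ : ZMod n)) N (α : ZMod n) := by
  unfold latticeCount boxResidueCount
  congr 1
  refine filter_congr fun a _ => ?_
  rw [← ZMod.intCast_zmod_eq_zero_iff_dvd]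
  push_cast
  exact sub_eq_zero

theorem theta_empty_eq_latticeCount {d : ℕ} (n : ℕ) (t : Fin d → ℕ) (α : ℤ) (r : ℕ) :
    theta n t α ∅ r = latticeCount n t α r := by
  let e : {ℓ : Fin d // ℓ ∉ (∅ : Finset (Fin d))} ≃ Fin d :=
    Equiv.subtypeUnivEquiv fun ℓ => notMem_empty ℓ
  unfold theta latticeCount
  refine card_equiv (e.arrowCongr (Equiv.refl ℕ)) fun a => ?_
  have hsum : ∑ ℓ : {ℓ : Fin d // ℓ ∉ (∅ : Finset (Fin d))}, (t ℓ.1 : ℤ) * a ℓ =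
      ∑ ℓ, (t ℓ : ℤ) * (e.arrowCongr (Equiv.refl ℕ) a ℓ : ℕ) :=
    Fintype.sum_equiv e _ _ fun _ => rfl
  have hbox : (∀ ℓ, a ℓ ∈ range r) ↔ ∀ ℓ, e.arrowCongr (Equiv.refl ℕ) a ℓ ∈ range r :=
    e.forall_congr fun _ => Iff.rfl
  simp only [mem_filter, Fintype.mem_piFinset, hsum, hbox, gJ, gcd_empty, Nat.gcd_zero_left]

/-- Corollary 4.13 of the paper: if `gcd(t_ℓ, n) = 1` for all `ℓ` and
`N = kn + r` with `0 < r < n`, then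
`n · |{0,…,N−1}^d ∩ 𝒜^{(α)}| = N^d − r^d + n · θ_∅^{(α)}(r)`,
i.e. the lattice-point count is `(N^d − r^d)/n + θ_∅^{(α)}(r)`. -/
theorem stmt8 {d n : ℕ} (hd : 1 ≤ d) (hn : 2 ≤ n) (t : Fin d → ℕ)
    (hgcd : ∀ ℓ, Nat.gcd (t ℓ) n = 1) (α : ℤ) (k r N : ℕ)
    (hr0 : 0 < r) (hrn : r < n) (hN : N = k * n + r) :
    (n : ℤ) * latticeCount n t α N =
      (N : ℤ) ^ d - (r : ℤ) ^ d + (n : ℤ) * theta n t α ∅ r := by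
  have : NeZero n := ⟨by omega⟩
  subst hN
  rw [theta_empty_eq_latticeCount, latticeCount_eq_boxResidueCount,
    latticeCount_eq_boxResidueCount]
  linarith [mul_boxResidueCount_sub_pow (fun ℓ => (t ℓ : ZMod n))
    (fun ℓ => (ZMod.isUnit_iff_coprime _ _).2 (hgcd ℓ)) k r (α : ZMod n)]
end

section
/- Let d ≥ 1, n ≥ 1, let t₁,…,t_d be natural numbers, and let N ≥ 1 be an integer with N ≡ 1 (mod n). For j ∈ {0,…,n−1} let f(j) = #{ℓ ∈ {1,…,d} : n divides j·t_ℓ}. Then n times the number of tuples (a₁,…,a_d) of integers with 0 ≤ a_ℓ ≤ N−1 for all ℓ and t₁a₁ + ⋯ + t_d a_d ≡ 0 (mod n) equals ∑_{j=0}^{n−1} N^{f(j)}. -/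
open Finset

theorem IsPrimitiveRoot.sum_range_pow_pow {R : Type*} [CommRing R] [IsDomain R] {ζ : R} {n : ℕ}
    (hζ : IsPrimitiveRoot ζ n) (m : ℕ) :
    ∑ k ∈ range n, (ζ ^ m) ^ k = if n ∣ m then (n : R) else 0 := by
  split_ifs with h
  · simp [(hζ.pow_eq_one_iff_dvd m).2 h]
  · have hx : ζ ^ m - 1 ≠ 0 := sub_ne_zero.2 fun e => h ((hζ.pow_eq_one_iff_dvd m).1 e)
    apply mul_right_cancel₀ hx
    rw [geom_sum_mul, ← pow_mul, mul_comm, pow_mul, hζ.pow_eq_one]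
    simp

theorem IsPrimitiveRoot.sum_range_pow_pow_of_modEq_one {R : Type*} [CommRing R] [IsDomain R]
    {ζ : R} {n N : ℕ} (hζ : IsPrimitiveRoot ζ n) (hN : 1 ≤ N) (hmod : N ≡ 1 [MOD n]) (m : ℕ) :
    ∑ k ∈ range N, (ζ ^ m) ^ k = if n ∣ m then (N : R) else 1 := by
  split_ifs with h
  · simp [(hζ.pow_eq_one_iff_dvd m).2 h]
  · have hx : ζ ^ m - 1 ≠ 0 := sub_ne_zero.2 fun e => h ((hζ.pow_eq_one_iff_dvd m).1 e)
    obtain ⟨c, hc⟩ := (Nat.modEq_iff_dvd' hN).1 hmod.symm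
    obtain rfl : N = n * c + 1 := by omega
    apply mul_right_cancel₀ hx
    rw [geom_sum_mul, pow_succ, ← pow_mul, mul_left_comm, pow_mul, hζ.pow_eq_one]
    simp

/-- The cyclic-group instance of Corollary 3.9 of the paper: for
`N ≡ 1 (mod n)` and `f(j) = #{ℓ : n ∣ j·t_ℓ}`,
`n · #{a ∈ {0,…,N−1}^d : ∑ t_ℓ a_ℓ ≡ 0 (mod n)} = ∑_{j=0}^{n−1} N^{f(j)}`. -/
theorem stmt10 (d n N : ℕ) (hd : 1 ≤ d) (hn : 1 ≤ n) (hN : 1 ≤ N)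
    (hmod : N ≡ 1 [MOD n]) (t : Fin d → ℕ) :
    n * ((Fintype.piFinset fun _ : Fin d => Finset.range N).filter
        fun a => n ∣ ∑ ℓ, t ℓ * a ℓ).card =
      ∑ j ∈ Finset.range n,
        N ^ (Finset.univ.filter fun ℓ : Fin d => n ∣ j * t ℓ).card := by
  have hζ := Complex.isPrimitiveRoot_exp n (by omega)
  set ζ := Complex.exp (2 * Real.pi * Complex.I / n)
  suffices h : ((n * ((Fintype.piFinset fun _ : Fin d => Finset.range N).filter
        fun a => n ∣ ∑ ℓ, t ℓ * a ℓ).card : ℕ) : ℂ) = ((∑ j ∈ Finset.range n,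
        N ^ (Finset.univ.filter fun ℓ : Fin d => n ∣ j * t ℓ).card : ℕ) : ℂ) from
    Nat.cast_injective h
  calc ((n * ((Fintype.piFinset fun _ : Fin d => Finset.range N).filter
        fun a => n ∣ ∑ ℓ, t ℓ * a ℓ).card : ℕ) : ℂ)
      = ∑ a ∈ Fintype.piFinset fun _ : Fin d => range N,
          if n ∣ ∑ ℓ, t ℓ * a ℓ then (n : ℂ) else 0 := by
        rw [← sum_filter, sum_const, nsmul_eq_mul]
        push_cast
        ring
    _ = ∑ j ∈ range n, ∑ a ∈ Fintype.piFinset fun _ : Fin d => range N,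
          ∏ ℓ, (ζ ^ (j * t ℓ)) ^ a ℓ := by
        rw [sum_comm]
        refine sum_congr rfl fun a _ => ?_
        rw [← hζ.sum_range_pow_pow]
        refine sum_congr rfl fun j _ => ?_
        simp_rw [← pow_mul]
        rw [prod_pow_eq_pow_sum, sum_mul]
        congr 1
        exact sum_congr rfl fun ℓ _ => by ring
    _ = ∑ j ∈ range n, ∏ ℓ, ∑ k ∈ range N, (ζ ^ (j * t ℓ)) ^ k := by
        simp_rw [prod_univ_sum]
    _ = _ := by
        push_cast
        refine sum_congr rfl fun j _ => ?_
        simp_rw [hζ.sum_range_pow_pow_of_modEq_one hN hmod]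
        rw [← prod_filter, prod_const]
end

section
/- Let n ≥ 2 and let N = kn + r with integers k ≥ 0 and 0 < r < n. Then n times the number of pairs (a,b) of integers with 0 ≤ a,b ≤ N−1 and n dividing a+b equals N² − r² + n·max(1, 2r−n); equivalently, the count is (N² − r²)/n + max(1, 2r−n). -/
open Finset

/-- The number of pairs `(a, b)` with `a < M`, `b < P` and `n ∣ a + b`, as a double sum. -/
def dvdAddCount (n M P : ℕ) : ℕ :=
  ∑ a ∈ range M, ∑ b ∈ range P, if n ∣ a + b then 1 else 0

theorem sum_range_ite_dvd_add {n : ℕ} (hn : 0 < n) (a P : ℕ) :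
    (∑ b ∈ range P, if n ∣ a + b then 1 else 0) + (a + n - 1) / n = (a + P + n - 1) / n := by
  induction P with
  | zero => simp
  | succ P ih =>
    have h : (a + P + n - 1 + 1) / n = _ := Nat.succ_div
    rw [show a + P + n - 1 + 1 = a + P + n by omega] at h
    simp only [Nat.dvd_add_self_right] at h
    rw [sum_range_succ, show a + (P + 1) + n - 1 = a + P + n by omega, h]
    omega

theorem dvdAddCount_comm (n M P : ℕ) : dvdAddCount n M P = dvdAddCount n P M := by
  unfold dvdAddCount
  rw [sum_comm]
  simp only [add_comm]

theorem dvdAddCount_add_right {n : ℕ} (hn : 0 < n) (M P : ℕ) :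
    dvdAddCount n M (P + n) = dvdAddCount n M P + M := by
  have key (a : ℕ) : (∑ b ∈ range (P + n), if n ∣ a + b then 1 else 0) =
      (∑ b ∈ range P, if n ∣ a + b then 1 else 0) + 1 := by
    have h₁ := sum_range_ite_dvd_add hn a (P + n)
    have h₂ := sum_range_ite_dvd_add hn a P
    rw [show a + (P + n) + n - 1 = a + P + n - 1 + n by omega, Nat.add_div_right _ hn] at h₁
    omega
  simp [dvdAddCount, key, sum_add_distrib]

theorem dvdAddCount_add_self {n : ℕ} (hn : 0 < n) (M : ℕ) :
    dvdAddCount n (M + n) (M + n) = dvdAddCount n M M + 2 * M + n := by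
  rw [dvdAddCount_add_right hn, dvdAddCount_comm, dvdAddCount_add_right hn]
  ring

theorem dvdAddCount_of_lt {n r s : ℕ} (hrn : r < n) (hs : s < r) :
    (dvdAddCount n (s + 1) r : ℤ) = max 1 ((s : ℤ) + 1 + r - n) := by
  have hn : 0 < n := by omega
  induction s with
  | zero =>
    have h := sum_range_ite_dvd_add hn 0 r
    rw [Nat.div_eq_of_lt (show 0 + n - 1 < n by omega),
      show 0 + r + n - 1 = r - 1 + n by omega, Nat.add_div_right _ hn,
      Nat.div_eq_of_lt (show r - 1 < n by omega)] at h
    simp only [dvdAddCount, zero_add, sum_range_one] at h ⊢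
    omega
  | succ s ih =>
    have h := sum_range_ite_dvd_add hn (s + 1) r
    rw [show s + 1 + n - 1 = s + n by omega, show s + 1 + r + n - 1 = s + r + n by omega,
      Nat.add_div_right _ hn, Nat.add_div_right _ hn,
      Nat.div_eq_of_lt (show s < n by omega)] at h
    have ih := ih (by omega)
    have h_succ : dvdAddCount n (s + 1 + 1) r = dvdAddCount n (s + 1) r +
        ∑ b ∈ range r, if n ∣ s + 1 + b then 1 else 0 := sum_range_succ _ _
    rw [h_succ]
    generalize (∑ b ∈ range r, if n ∣ s + 1 + b then 1 else 0) = c at h ⊢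
    push_cast
    rcases lt_or_ge (s + r) n with hlt | hge
    · rw [Nat.div_eq_of_lt hlt] at h
      omega
    · rw [show s + r = s + r - n + n by omega, Nat.add_div_right _ hn,
        Nat.div_eq_of_lt (show s + r - n < n by omega)] at h
      omega

/-- Example 5.3 of the paper (the 2-dimensional `n`-th Veronese ring, i.e. the
cyclic quotient singularity `1/n(1,1)`): for `N = kn + r` with `0 < r < n`,
`n · #{(a,b) : 0 ≤ a,b ≤ N−1, n ∣ a+b} = N² − r² + n · max(1, 2r−n)`,
i.e. the count is `(N² − r²)/n + max(1, 2r−n)`. -/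
theorem stmt12 (n k r N : ℕ) (hn : 2 ≤ n) (hr0 : 0 < r) (hrn : r < n)
    (hN : N = k * n + r) :
    (n : ℤ) * ((Finset.range N ×ˢ Finset.range N).filter
        fun ab => n ∣ ab.1 + ab.2).card =
      (N : ℤ) ^ 2 - (r : ℤ) ^ 2 + (n : ℤ) * max 1 (2 * (r : ℤ) - (n : ℤ)) := by
  have hcard : ((Finset.range N ×ˢ Finset.range N).filter
      fun ab => n ∣ ab.1 + ab.2).card = dvdAddCount n N N := by
    rw [card_filter, sum_product, dvdAddCount]
  rw [hcard]
  clear hcard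
  subst hN
  induction k with
  | zero =>
    obtain ⟨s, rfl⟩ : ∃ s, r = s + 1 := ⟨r - 1, by omega⟩
    have h := dvdAddCount_of_lt hrn (Nat.lt_succ_self s)
    simp only [zero_mul, zero_add, sub_self]
    rw [h]
    congr 2
    push_cast
    ring
  | succ k ih =>
    rw [show (k + 1) * n + r = k * n + r + n by ring, dvdAddCount_add_self (by omega)]
    push_cast at ih ⊢
    linear_combination ih
end

section
/- Let n ≥ 2 and let r be an integer with 0 < r < n. Then the number of triples (a,b,c) of integers with 0 ≤ a,b,c ≤ r−1 and n dividing a+b+c equals 1 + binom(3r−n−1, 2) − 3·binom(2r−n−1, 2) + binom(3r−2n−1, 2), with the convention that binom(u,2) = 0 whenever u < 2 (in particular whenever the argument is negative). -/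
open Finset

/-- The triples of natural numbers with sum `M`. -/
def sumTriples (M : ℕ) : Finset (ℕ × ℕ × ℕ) :=
  (range (M + 1) ×ˢ range (M + 1) ×ˢ range (M + 1)).filter fun t => t.1 + t.2.1 + t.2.2 = M

/-- The triples of natural numbers below `r` with sum `m`. -/
def boxTriples (r m : ℕ) : Finset (ℕ × ℕ × ℕ) :=
  (range r ×ˢ range r ×ˢ range r).filter fun t => t.1 + t.2.1 + t.2.2 = m

lemma mem_sumTriples {M : ℕ} {t : ℕ × ℕ × ℕ} :
    t ∈ sumTriples M ↔ t.1 + t.2.1 + t.2.2 = M := by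
  simp only [sumTriples, mem_filter, mem_product, mem_range]
  omega

lemma mem_boxTriples {r m : ℕ} {t : ℕ × ℕ × ℕ} :
    t ∈ boxTriples r m ↔ (t.1 < r ∧ t.2.1 < r ∧ t.2.2 < r) ∧ t.1 + t.2.1 + t.2.2 = m := by
  simp only [boxTriples, mem_filter, mem_product, mem_range]

lemma card_sumTriples_fst_ge_of_le {M r : ℕ} (h : r ≤ M) :
    ((sumTriples M).filter fun t => r ≤ t.1).card = (sumTriples (M - r)).card := by
  apply Finset.card_nbij' (fun t => (t.1 - r, t.2.1, t.2.2)) (fun t => (t.1 + r, t.2.1, t.2.2)) <;>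
    rintro ⟨a, b, c⟩ <;>
    simp only [mem_filter, mem_coe, mem_sumTriples, Prod.mk.injEq, and_true] <;> omega

lemma card_sumTriples_fst_eq_zero (M : ℕ) :
    ((sumTriples M).filter fun t => ¬ 1 ≤ t.1).card = M + 1 := by
  rw [← card_range (M + 1)]
  apply Finset.card_nbij' (fun t => t.2.1) (fun b => (0, b, M - b))
  · rintro ⟨a, b, c⟩
    simp only [mem_filter, mem_coe, mem_sumTriples, mem_range]
    omega
  · intro b
    simp only [mem_filter, mem_coe, mem_sumTriples, mem_range]
    omega
  · rintro ⟨a, b, c⟩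
    simp only [mem_filter, mem_coe, mem_sumTriples, Prod.mk.injEq, true_and]
    omega
  · intro b _
    rfl

lemma card_sumTriples (M : ℕ) : (sumTriples M).card = (M + 2).choose 2 := by
  induction M with
  | zero => decide
  | succ M ih =>
    rw [← card_filter_add_card_filter_not (s := sumTriples (M + 1)) fun t => 1 ≤ t.1,
      card_sumTriples_fst_ge_of_le (by omega), card_sumTriples_fst_eq_zero,
      Nat.add_sub_cancel, ih, Nat.choose_succ_succ' (M + 2) 1, Nat.choose_one_right]
    ring

lemma card_sumTriples_fst_ge (M r : ℕ) :
    ((sumTriples M).filter fun t => r ≤ t.1).card = (M + 2 - r).choose 2 := by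
  by_cases h : r ≤ M
  · rw [card_sumTriples_fst_ge_of_le h, card_sumTriples, Nat.sub_add_comm h]
  · rw [Nat.choose_eq_zero_of_lt (by omega), card_eq_zero, filter_eq_empty_iff]
    intro t
    rw [mem_sumTriples]
    omega

lemma card_sumTriples_snd_ge (M r : ℕ) :
    ((sumTriples M).filter fun t => r ≤ t.2.1).card = (M + 2 - r).choose 2 := by
  rw [← card_sumTriples_fst_ge]
  apply Finset.card_nbij' (fun t => (t.2.1, t.1, t.2.2)) (fun t => (t.2.1, t.1, t.2.2)) <;>
    rintro ⟨a, b, c⟩ <;> simp only [mem_filter, mem_coe, mem_sumTriples, implies_true] <;> omega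

lemma card_sumTriples_trd_ge (M r : ℕ) :
    ((sumTriples M).filter fun t => r ≤ t.2.2).card = (M + 2 - r).choose 2 := by
  rw [← card_sumTriples_fst_ge]
  apply Finset.card_nbij' (fun t => (t.2.2, t.2.1, t.1)) (fun t => (t.2.2, t.2.1, t.1)) <;>
    rintro ⟨a, b, c⟩ <;> simp only [mem_filter, mem_coe, mem_sumTriples, implies_true] <;> omega

lemma card_boxTriples_of_lt {r M : ℕ} (h : M < 2 * r) :
    (boxTriples r M).card + 3 * (M + 2 - r).choose 2 = (M + 2).choose 2 := by
  have hbox : boxTriples r M =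
      (sumTriples M).filter fun t => t.1 < r ∧ t.2.1 < r ∧ t.2.2 < r := by
    ext t
    rw [mem_boxTriples, mem_filter, mem_sumTriples, and_comm]
  have key : (boxTriples r M).card + ((sumTriples M).filter fun t => r ≤ t.1).card
      + ((sumTriples M).filter fun t => r ≤ t.2.1).card
      + ((sumTriples M).filter fun t => r ≤ t.2.2).card = (sumTriples M).card := by
    rw [hbox]
    simp only [card_filter]
    rw [card_eq_sum_ones, ← sum_add_distrib, ← sum_add_distrib, ← sum_add_distrib]
    refine sum_congr rfl fun t ht => ?_
    rw [mem_sumTriples] at ht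
    split_ifs <;> omega
  rw [card_sumTriples_fst_ge, card_sumTriples_snd_ge, card_sumTriples_trd_ge,
    card_sumTriples] at key
  omega

lemma card_boxTriples_reflect {r m : ℕ} (h : m + 3 ≤ 3 * r) :
    (boxTriples r m).card = (boxTriples r (3 * r - 3 - m)).card := by
  apply Finset.card_nbij' (fun t => (r - 1 - t.1, r - 1 - t.2.1, r - 1 - t.2.2))
    (fun t => (r - 1 - t.1, r - 1 - t.2.1, r - 1 - t.2.2)) <;>
    rintro ⟨a, b, c⟩ <;> simp only [mem_coe, mem_boxTriples, Prod.mk.injEq] <;> omega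

lemma card_boxTriples {r m : ℕ} (h : r < m) :
    (boxTriples r m).card + 3 * (2 * r - 1 - m).choose 2 = (3 * r - 1 - m).choose 2 := by
  by_cases hm : m + 3 ≤ 3 * r
  · have := card_boxTriples_of_lt (r := r) (M := 3 * r - 3 - m) (by omega)
    rw [card_boxTriples_reflect hm]
    rwa [show 3 * r - 3 - m + 2 - r = 2 * r - 1 - m by omega,
      show 3 * r - 3 - m + 2 = 3 * r - 1 - m by omega] at this
  · rw [Nat.choose_eq_zero_of_lt (n := 2 * r - 1 - m) (by omega),
      Nat.choose_eq_zero_of_lt (n := 3 * r - 1 - m) (by omega), mul_zero, add_zero,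
      card_eq_zero, eq_empty_iff_forall_notMem]
    intro t
    rw [mem_boxTriples]
    omega

lemma card_boxTriples_zero {r : ℕ} (h : 0 < r) : (boxTriples r 0).card = 1 := by
  rw [card_eq_one]
  refine ⟨(0, 0, 0), ?_⟩
  ext ⟨a, b, c⟩
  simp only [mem_boxTriples, mem_singleton, Prod.mk.injEq]
  omega

lemma card_box_filter_dvd {n r : ℕ} (hrn : r < n) :
    ((range r ×ˢ range r ×ˢ range r).filter fun t => n ∣ t.1 + t.2.1 + t.2.2).card =
      (boxTriples r 0).card + (boxTriples r n).card + (boxTriples r (2 * n)).card := by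
  simp only [boxTriples, card_filter]
  rw [← sum_add_distrib, ← sum_add_distrib]
  refine sum_congr rfl fun t ht => ?_
  simp only [mem_product, mem_range] at ht
  have hdvd : n ∣ t.1 + t.2.1 + t.2.2 ↔ t.1 + t.2.1 + t.2.2 = 0 ∨
      t.1 + t.2.1 + t.2.2 = n ∨ t.1 + t.2.1 + t.2.2 = 2 * n := by
    constructor
    · rintro ⟨k, hk⟩
      have hk3 : k < 3 := by
        by_contra! hk3
        have := Nat.mul_le_mul_left n hk3
        omega
      interval_cases k <;> omega
    · rintro (h | h | h) <;> simp [h]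
  simp only [hdvd]
  split_ifs <;> omega

/-- Example 5.5 of the paper (the 3-dimensional `n`-th Veronese ring): for
`0 < r < n`, the number of triples `(a,b,c)` with `0 ≤ a,b,c ≤ r−1` and
`n ∣ a+b+c` equals
`1 + binom(3r−n−1,2) − 3·binom(2r−n−1,2) + binom(3r−2n−1,2)`,
with the convention that `binom(u,2) = 0` whenever `u < 2` (in particular for
negative `u`; this is implemented via `Int.toNat`). -/
theorem stmt13 (n r : ℕ) (hn : 2 ≤ n) (hr0 : 0 < r) (hrn : r < n) :
    (((Finset.range r ×ˢ Finset.range r ×ˢ Finset.range r).filter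
        fun abc => n ∣ abc.1 + abc.2.1 + abc.2.2).card : ℤ) =
      1 + ((3 * (r : ℤ) - n - 1).toNat.choose 2 : ℤ)
        - 3 * ((2 * (r : ℤ) - n - 1).toNat.choose 2 : ℤ)
        + ((3 * (r : ℤ) - 2 * n - 1).toNat.choose 2 : ℤ) := by
  rw [card_box_filter_dvd hrn, card_boxTriples_zero hr0]
  have h1 := card_boxTriples hrn
  have h2 := card_boxTriples (r := r) (m := 2 * n) (by omega)
  rw [Nat.choose_eq_zero_of_lt (n := 2 * r - 1 - 2 * n) (by omega)] at h2
  rw [show (3 * (r : ℤ) - n - 1).toNat = 3 * r - 1 - n by omega,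
    show (2 * (r : ℤ) - n - 1).toNat = 2 * r - 1 - n by omega,
    show (3 * (r : ℤ) - 2 * n - 1).toNat = 3 * r - 1 - 2 * n by omega]
  omega
end

section
/- Let N ≥ 1 be an integer with N ≡ 1 (mod 6), and for an integer α let c_α denote the number of triples (a,b,c) of integers with 0 ≤ a,b,c ≤ N−1 and a + 2b + 3c ≡ α (mod 6). Then 6·c_0 = N³ + 3N + 2, 6·c_1 = 6·c_5 = N³ − 2N + 1, 6·c_2 = 6·c_4 = N³ − 1, and 6·c_3 = N³ + N − 2. -/
open Finset

/-- The number of triples `(a,b,c)` of integers with `0 ≤ a,b,c ≤ N−1` and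
`a + 2b + 3c ≡ α (mod 6)`. -/
def iyCount (N : ℕ) (α : ℤ) : ℕ :=
  ((Finset.range N ×ˢ Finset.range N ×ˢ Finset.range N).filter
    fun abc => (6 : ℤ) ∣ ((abc.1 : ℤ) + 2 * abc.2.1 + 3 * abc.2.2 - α)).card

/-- A function on `ZMod 6` summed along `0, …, 6k` runs through `k` full periods and one extra
zero. -/
lemma sum_range_six_mul_add_one (k : ℕ) (g : ZMod 6 → ℤ) :
    ∑ x ∈ range (6 * k + 1), g x = k * ∑ r, g r + g 0 := by
  induction k with
  | zero => simp
  | succ k ih =>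
    have h6 : (6 : ZMod 6) = 0 := rfl
    have hsum : ∑ r, g r = g 0 + g 1 + g 2 + g 3 + g 4 + g 5 := Fin.sum_univ_six g
    have hx : ((6 * k : ℕ) : ZMod 6) = 0 := by rw [Nat.cast_mul]; simp [h6]
    have h : ∀ i : ℕ, ((6 * k + i : ℕ) : ZMod 6) = i := fun i => by rw [Nat.cast_add, hx, zero_add]
    rw [hsum] at ih ⊢
    rw [show 6 * (k + 1) + 1 = 6 * k + 6 + 1 by ring]
    rw [sum_range_succ, sum_range_succ _ (6 * k + 5), sum_range_succ _ (6 * k + 4),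
      sum_range_succ _ (6 * k + 3), sum_range_succ _ (6 * k + 2), sum_range_succ _ (6 * k + 1), ih]
    simp only [h]
    push_cast
    rw [h6]
    ring

lemma iyCount_eq_sum (N : ℕ) (α : ℤ) :
    (iyCount N α : ℤ) = ∑ a ∈ range N, ∑ b ∈ range N, ∑ c ∈ range N,
      if (a + 2 * b + 3 * c : ZMod 6) = α then 1 else 0 := by
  rw [iyCount, card_filter, sum_product]
  simp only [sum_product]
  push_cast
  refine sum_congr rfl fun a _ => sum_congr rfl fun b _ => sum_congr rfl fun c _ => ?_
  have h := ZMod.intCast_zmod_eq_zero_iff_dvd ((a : ℤ) + 2 * b + 3 * c - α) 6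
  push_cast at h
  rw [sub_eq_zero] at h
  simp only [h]

/-- For `N = 6k + 1` the count is a cubic polynomial in `k`, whose coefficients count the solutions
in `ZMod 6` with some of the variables set to zero. -/
lemma iyCount_six_mul_add_one (k : ℕ) {α : ℤ} {β : ZMod 6} {p q r s : ℤ} (hβ : (α : ZMod 6) = β)
    (hp : (∑ a : ZMod 6, ∑ b : ZMod 6, ∑ c : ZMod 6,
      if a + 2 * b + 3 * c = β then 1 else 0) = p)
    (hq : (∑ a : ZMod 6, ∑ b : ZMod 6, if a + 2 * b = β then 1 else 0) +
      (∑ a : ZMod 6, ∑ c : ZMod 6, if a + 3 * c = β then 1 else 0) +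
      (∑ b : ZMod 6, ∑ c : ZMod 6, if 2 * b + 3 * c = β then 1 else 0) = q)
    (hr : (∑ a : ZMod 6, if a = β then 1 else 0) + (∑ b : ZMod 6, if 2 * b = β then 1 else 0) +
      (∑ c : ZMod 6, if 3 * c = β then 1 else 0) = r)
    (hs : (if 0 = β then 1 else 0) = s) :
    (iyCount (6 * k + 1) α : ℤ) = p * k ^ 3 + q * k ^ 2 + r * k + s := by
  subst hp hq hr hs
  rw [iyCount_eq_sum, hβ]
  simp only [fun s : ZMod 6 => sum_range_six_mul_add_one k fun c => if s + 3 * c = β then 1 else 0]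
  simp only [fun a : ZMod 6 => sum_range_six_mul_add_one k fun b =>
    (k : ℤ) * (∑ c : ZMod 6, if a + 2 * b + 3 * c = β then 1 else 0) +
      if a + 2 * b + 3 * 0 = β then 1 else 0]
  rw [sum_range_six_mul_add_one k fun a =>
    (k : ℤ) * (∑ b : ZMod 6, ((k : ℤ) * (∑ c : ZMod 6, if a + 2 * b + 3 * c = β then 1 else 0) +
      if a + 2 * b + 3 * 0 = β then 1 else 0)) +
    ((k : ℤ) * (∑ c : ZMod 6, if a + 2 * 0 + 3 * c = β then 1 else 0) +
      if a + 2 * 0 + 3 * 0 = β then 1 else 0)]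
  simp only [sum_add_distrib, ← mul_sum, mul_zero, add_zero, zero_add]
  ring

/-- Example 4.12 of the paper (the cyclic quotient singularity `1/6(1,2,3)`):
for `N ≡ 1 (mod 6)`,
`6·c₀ = N³ + 3N + 2`, `6·c₁ = 6·c₅ = N³ − 2N + 1`, `6·c₂ = 6·c₄ = N³ − 1`,
and `6·c₃ = N³ + N − 2`. -/
theorem stmt15 (N : ℕ) (hN : 1 ≤ N) (hmod : N ≡ 1 [MOD 6]) :
    (6 : ℤ) * iyCount N 0 = (N : ℤ) ^ 3 + 3 * N + 2 ∧
      (6 : ℤ) * iyCount N 1 = (N : ℤ) ^ 3 - 2 * N + 1 ∧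
      (6 : ℤ) * iyCount N 5 = (N : ℤ) ^ 3 - 2 * N + 1 ∧
      (6 : ℤ) * iyCount N 2 = (N : ℤ) ^ 3 - 1 ∧
      (6 : ℤ) * iyCount N 4 = (N : ℤ) ^ 3 - 1 ∧
      (6 : ℤ) * iyCount N 3 = (N : ℤ) ^ 3 + N - 2 := by
  obtain ⟨k, rfl⟩ : ∃ k, N = 6 * k + 1 := ⟨N / 6, by have := hmod; unfold Nat.ModEq at this; omega⟩
  refine ⟨?_, ?_, ?_, ?_, ?_, ?_⟩
  · rw [iyCount_six_mul_add_one k (p := 36) (q := 18) (r := 6) (s := 1) (β := 0) rfl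
      (by decide) (by decide) (by decide) (by decide)]
    push_cast
    ring
  · rw [iyCount_six_mul_add_one k (p := 36) (q := 18) (r := 1) (s := 0) (β := 1) rfl
      (by decide) (by decide) (by decide) (by decide)]
    push_cast
    ring
  · rw [iyCount_six_mul_add_one k (p := 36) (q := 18) (r := 1) (s := 0) (β := 5) rfl
      (by decide) (by decide) (by decide) (by decide)]
    push_cast
    ring
  · rw [iyCount_six_mul_add_one k (p := 36) (q := 18) (r := 3) (s := 0) (β := 2) rfl
      (by decide) (by decide) (by decide) (by decide)]
    push_cast
    ring
  · rw [iyCount_six_mul_add_one k (p := 36) (q := 18) (r := 3) (s := 0) (β := 4) rfl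
      (by decide) (by decide) (by decide) (by decide)]
    push_cast
    ring
  · rw [iyCount_six_mul_add_one k (p := 36) (q := 18) (r := 4) (s := 0) (β := 3) rfl
      (by decide) (by decide) (by decide) (by decide)]
    push_cast
    ring
end
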